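/- arXiv:2507.00725 — 5 statements merged into one kernel-verified Lean document; each statement's English description precedes it below -/
import Mathlib

section
/- Let K be an abstract simplicial complex on a vertex type V, and suppose g : V → ℝ is obtained from f : V → ℝ by a single crossing of two vertices u and v of K. Then χ̃(Lk⁻_g(v)) − χ̃(Lk⁻_f(v)) = −( χ̃(Lk⁻_g(u)) − χ̃(Lk⁻_f(u)) ). Equivalently, writing β_i^f(w) for the Betti numbers of the lower link of w with respect to f, one has Σ_{i}(−1)^i (β_i^g(v) − β_i^f(v)) = − Σ_{i}(−1)^i (β_i^g(u) − β_i^f(u)). (This is Theorem 1 of the paper, stated at the level of Euler characteristics of lower links, to which the alternating sums of Betti numbers are equal.) -/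
open Finset

open scoped Classical

/-- An abstract simplicial complex on vertex type `V`: a finite collection of
nonempty finite subsets, closed under passing to nonempty subsets. -/
def IsComplex {V : Type*} [DecidableEq V] (K : Finset (Finset V)) : Prop :=
  (∀ σ ∈ K, σ.Nonempty) ∧ ∀ σ ∈ K, ∀ τ ⊆ σ, τ.Nonempty → τ ∈ K

/-- `v` is a vertex of `K` if it belongs to some simplex. -/
def IsVertex {V : Type*} [DecidableEq V] (K : Finset (Finset V)) (v : V) : Prop :=
  ∃ σ ∈ K, v ∈ σ

/-- `f` is injective on the vertices of `K`. -/
def InjOnVerts {V : Type*} [DecidableEq V] (K : Finset (Finset V)) (f : V → ℝ) : Prop :=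
  ∀ a b, IsVertex K a → IsVertex K b → f a = f b → a = b

/-- The lower link of a vertex `w` with respect to `f`. -/
noncomputable def lowerLink {V : Type*} [DecidableEq V] (K : Finset (Finset V))
    (f : V → ℝ) (w : V) : Finset (Finset V) :=
  K.filter (fun τ => w ∉ τ ∧ insert w τ ∈ K ∧ ∀ x ∈ τ, f x < f w)

/-- Reduced Euler characteristic of a finite collection of nonempty finite sets. -/
noncomputable def chiTilde {V : Type*} [DecidableEq V] (L : Finset (Finset V)) : ℤ :=
  (∑ τ ∈ L, (-1 : ℤ) ^ (τ.card - 1)) - 1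

/-- The cone `v ⋆ L`. -/
noncomputable def cone {V : Type*} [DecidableEq V] (v : V) (L : Finset (Finset V)) :
    Finset (Finset V) :=
  L ∪ L.image (insert v) ∪ {{v}}

/-- `g` is obtained from `f` by a single crossing of the vertices `u` and `v` of `K`. -/
structure IsCrossing {V : Type*} [DecidableEq V] (K : Finset (Finset V))
    (f g : V → ℝ) (u v : V) : Prop where
  injf : InjOnVerts K f
  injg : InjOnVerts K g
  hu : IsVertex K u
  hv : IsVertex K v
  huv : f u < f v
  hvu : g v < g u
  others : ∀ a b, IsVertex K a → IsVertex K b → ({a, b} : Set V) ≠ ({u, v} : Set V) →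
    (f a < f b ↔ g a < g b)

/-- `I_uv`, the lower link of the edge `{u, v}` with respect to `f`. -/
noncomputable def edgeLowerLink {V : Type*} [DecidableEq V] (K : Finset (Finset V))
    (f : V → ℝ) (u v : V) : Finset (Finset V) :=
  K.filter (fun τ => u ∉ τ ∧ v ∉ τ ∧ insert u (insert v τ) ∈ K ∧
    ∀ x ∈ τ, f x < min (f u) (f v))

namespace IsCrossing

variable {V : Type*} [DecidableEq V] {K : Finset (Finset V)} {f g : V → ℝ} {u v : V}

theorem ne (h : IsCrossing K f g u v) : u ≠ v := fun e => (e ▸ h.huv).false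

/-- Undoing a crossing of `u` and `v` is a crossing of `v` and `u`. -/
theorem symm (h : IsCrossing K f g u v) : IsCrossing K g f v u where
  injf := h.injg
  injg := h.injf
  hu := h.hv
  hv := h.hu
  huv := h.hvu
  hvu := h.huv
  others a b ha hb hab := (h.others a b ha hb (by rwa [Set.pair_comm u v])).symm

/-- Vertices other than `u` keep their position relative to `v`. -/
theorem lt_iff_lt (h : IsCrossing K f g u v) {x : V} (hx : IsVertex K x) (hxu : x ≠ u) :
    f x < f v ↔ g x < g v := by
  refine h.others x v hx h.hv fun e => ?_
  have hu : u ∈ ({x, v} : Set V) := e ▸ Set.mem_insert u {v}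
  rcases hu with hu | hu
  · exact hxu hu.symm
  · exact h.ne hu

/-- The simplices that survive in the lower link of `v` are those avoiding `u`. -/
theorem lowerLink_eq_filter (h : IsCrossing K f g u v) :
    lowerLink K g v = {τ ∈ lowerLink K f v | u ∉ τ} := by
  ext τ
  simp only [lowerLink, mem_filter]
  constructor
  · rintro ⟨hτ, hvτ, hins, hlt⟩
    have huτ : u ∉ τ := fun hu => (hlt u hu).not_gt h.hvu
    exact ⟨⟨hτ, hvτ, hins, fun x hx =>
      (h.lt_iff_lt ⟨τ, hτ, hx⟩ (ne_of_mem_of_not_mem hx huτ)).2 (hlt x hx)⟩, huτ⟩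
  · rintro ⟨⟨hτ, hvτ, hins, hlt⟩, huτ⟩
    exact ⟨hτ, hvτ, hins, fun x hx =>
      (h.lt_iff_lt ⟨τ, hτ, hx⟩ (ne_of_mem_of_not_mem hx huτ)).1 (hlt x hx)⟩

theorem chiTilde_lowerLink (h : IsCrossing K f g u v) :
    chiTilde (lowerLink K f v) = chiTilde (lowerLink K g v) +
      ∑ τ ∈ lowerLink K f v with u ∈ τ, (-1 : ℤ) ^ (τ.card - 1) := by
  rw [h.lowerLink_eq_filter]
  simp only [chiTilde]
  rw [← sum_filter_add_sum_filter_not (lowerLink K f v) (fun τ => u ∈ τ)]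
  ring

/-- Exchanging `u` for `v` sends simplices through `u` in the lower link of `v` before the
crossing to simplices through `v` in the lower link of `u` after it. -/
theorem insert_erase_mem (h : IsCrossing K f g u v) (hK : IsComplex K) {τ : Finset V}
    (hτ : τ ∈ {τ ∈ lowerLink K f v | u ∈ τ}) :
    insert v (τ.erase u) ∈ {σ ∈ lowerLink K g u | v ∈ σ} := by
  simp only [lowerLink, mem_filter] at hτ ⊢
  obtain ⟨⟨hτK, -, hins, hlt⟩, huτ⟩ := hτ
  refine ⟨⟨hK.2 _ hins _ (insert_subset_insert v (erase_subset u τ)) (insert_nonempty _ _),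
    by simp [h.ne], by rwa [insert_comm, insert_erase huτ], fun x hx => ?_⟩,
    mem_insert_self _ _⟩
  rcases mem_insert.1 hx with rfl | hx
  · exact h.hvu
  · obtain ⟨hxu, hxτ⟩ := mem_erase.1 hx
    exact ((h.lt_iff_lt ⟨τ, hτK, hxτ⟩ hxu).1 (hlt x hxτ)).trans h.hvu

theorem insert_erase_insert_erase {τ : Finset V} (hτ : τ ∈ {τ ∈ lowerLink K f v | u ∈ τ}) :
    insert u ((insert v (τ.erase u)).erase v) = τ := by
  simp only [lowerLink, mem_filter] at hτ
  rw [erase_insert fun hv => hτ.1.2.1 (mem_of_mem_erase hv), insert_erase hτ.2]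

theorem sum_lowerLink_eq (h : IsCrossing K f g u v) (hK : IsComplex K) :
    ∑ τ ∈ lowerLink K f v with u ∈ τ, (-1 : ℤ) ^ (τ.card - 1) =
      ∑ σ ∈ lowerLink K g u with v ∈ σ, (-1 : ℤ) ^ (σ.card - 1) := by
  refine sum_bij' (fun τ _ => insert v (τ.erase u)) (fun σ _ => insert u (σ.erase v))
    (fun τ hτ => h.insert_erase_mem hK hτ) (fun σ hσ => h.symm.insert_erase_mem hK hσ)
    (fun τ hτ => insert_erase_insert_erase hτ) (fun σ hσ => insert_erase_insert_erase hσ)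
    fun τ hτ => ?_
  simp only [lowerLink, mem_filter] at hτ
  rw [card_insert_of_notMem fun hv => hτ.1.2.1 (mem_of_mem_erase hv),
    card_erase_add_one hτ.2]

end IsCrossing

/-- at a single crossing of `u` and `v`, the changes in the reduced Euler
characteristics of the lower links of `v` and of `u` are equal and opposite. -/
theorem crossing_chiTilde_antisymm {V : Type*} [DecidableEq V]
    (K : Finset (Finset V)) (hK : IsComplex K) (f g : V → ℝ) (u v : V)
    (hcross : IsCrossing K f g u v) :
    chiTilde (lowerLink K g v) - chiTilde (lowerLink K f v) =
      -(chiTilde (lowerLink K g u) - chiTilde (lowerLink K f u)) := by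
  linarith [hcross.chiTilde_lowerLink, hcross.symm.chiTilde_lowerLink,
    hcross.sum_lowerLink_eq hK]
end

section
/- Let K be an abstract simplicial complex on a vertex type V, let g : V → ℝ be obtained from f : V → ℝ by a single crossing of two vertices u and v of K, and suppose {u, v} ∈ K. Then the lower link of u after the crossing decomposes as Lk⁻_g(u) = Lk⁻_f(u) ∪ (v ⋆ I_uv), and moreover Lk⁻_f(u) ∩ (v ⋆ I_uv) = I_uv. -/
open Finset

open scoped Classical

theorem IsCrossing.lt_iff_lt_of_ne {V : Type*} [DecidableEq V] {K : Finset (Finset V)}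
    {f g : V → ℝ} {u v x : V} (h : IsCrossing K f g u v) (hx : IsVertex K x) (hxv : x ≠ v) :
    f x < f u ↔ g x < g u := by
  refine h.others x u hx h.hu fun heq => ?_
  have hv : v ∈ ({x, u} : Set V) := heq ▸ Set.mem_insert_of_mem u rfl
  rcases hv with rfl | rfl
  · exact hxv rfl
  · exact lt_irrefl _ h.huv

theorem mem_lowerLink {V : Type*} [DecidableEq V] {K : Finset (Finset V)} {f : V → ℝ} {w : V}
    {τ : Finset V} :
    τ ∈ lowerLink K f w ↔ τ ∈ K ∧ w ∉ τ ∧ insert w τ ∈ K ∧ ∀ x ∈ τ, f x < f w := by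
  simp [lowerLink]

theorem mem_edgeLowerLink_of_lt {V : Type*} [DecidableEq V] {K : Finset (Finset V)} {f : V → ℝ}
    {u v : V} (huv : f u < f v) {τ : Finset V} :
    τ ∈ edgeLowerLink K f u v ↔
      τ ∈ K ∧ u ∉ τ ∧ v ∉ τ ∧ insert u (insert v τ) ∈ K ∧ ∀ x ∈ τ, f x < f u := by
  simp [edgeLowerLink, min_eq_left huv.le]

theorem mem_cone {V : Type*} [DecidableEq V] {v : V} {L : Finset (Finset V)} {τ : Finset V} :
    τ ∈ cone v L ↔ τ ∈ L ∨ (∃ σ ∈ L, insert v σ = τ) ∨ τ = {v} := by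
  simp only [cone, mem_union, mem_image, mem_singleton, or_assoc]

theorem notMem_of_mem_lowerLink {V : Type*} [DecidableEq V] {K : Finset (Finset V)} {f : V → ℝ}
    {u v : V} (huv : f u < f v) {τ : Finset V} (hτ : τ ∈ lowerLink K f u) : v ∉ τ :=
  fun hv => lt_asymm huv ((mem_lowerLink.1 hτ).2.2.2 v hv)

theorem edgeLowerLink_subset_lowerLink {V : Type*} [DecidableEq V] {K : Finset (Finset V)}
    (hK : IsComplex K) {f : V → ℝ} {u v : V} (huv : f u < f v) :
    edgeLowerLink K f u v ⊆ lowerLink K f u := by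
  intro τ hτ
  obtain ⟨h, hu, -, he, hlt⟩ := (mem_edgeLowerLink_of_lt huv).1 hτ
  exact mem_lowerLink.2 ⟨h, hu, hK.2 _ he _ (insert_subset_insert _ (subset_insert _ _))
    (insert_nonempty _ _), hlt⟩

/-- if `{u,v} ∈ K`, then after the crossing the lower link of `u`
decomposes as `Lk⁻_g(u) = Lk⁻_f(u) ∪ (v ⋆ I_uv)`, with intersection `I_uv`. -/
theorem crossing_lowerLink_u_decomp {V : Type*} [DecidableEq V]
    (K : Finset (Finset V)) (hK : IsComplex K) (f g : V → ℝ) (u v : V)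
    (hcross : IsCrossing K f g u v) (hedge : ({u, v} : Finset V) ∈ K) :
    lowerLink K g u = lowerLink K f u ∪ cone v (edgeLowerLink K f u v) ∧
      lowerLink K f u ∩ cone v (edgeLowerLink K f u v) = edgeLowerLink K f u v := by
  have huv := hcross.huv
  have hne : u ≠ v := fun h => huv.ne (congrArg f h)
  have hIL := edgeLowerLink_subset_lowerLink hK huv
  have hLk : lowerLink K f u ⊆ lowerLink K g u := by
    intro τ hτ
    have hvτ := notMem_of_mem_lowerLink huv hτ
    obtain ⟨h, hu, he, hlt⟩ := mem_lowerLink.1 hτ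
    exact mem_lowerLink.2 ⟨h, hu, he, fun x hx =>
      (hcross.lt_iff_lt_of_ne ⟨τ, h, hx⟩ (ne_of_mem_of_not_mem hx hvτ)).1 (hlt x hx)⟩
  constructor
  · ext τ
    rw [mem_union, mem_cone]
    constructor
    · intro hτ
      obtain ⟨h, hu, he, hlt⟩ := mem_lowerLink.1 hτ
      have hltf : ∀ x ∈ τ, x ≠ v → f x < f u := fun x hx hxv =>
        (hcross.lt_iff_lt_of_ne ⟨τ, h, hx⟩ hxv).2 (hlt x hx)
      by_cases hv : v ∈ τ
      · right; right
        rcases (τ.erase v).eq_empty_or_nonempty with h0 | h0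
        · right
          rw [← insert_erase hv, h0, insert_empty_eq]
        · left
          refine ⟨τ.erase v, (mem_edgeLowerLink_of_lt huv).2
            ⟨hK.2 _ h _ (erase_subset _ _) h0, fun hm => hu (mem_of_mem_erase hm),
              notMem_erase _ _, by rwa [insert_erase hv],
              fun x hx => hltf x (mem_of_mem_erase hx) (ne_of_mem_erase hx)⟩, insert_erase hv⟩
      · exact Or.inl (mem_lowerLink.2
          ⟨h, hu, he, fun x hx => hltf x hx (ne_of_mem_of_not_mem hx hv)⟩)
    · rintro (hτ | hτ | ⟨σ, hσ, rfl⟩ | rfl)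
      · exact hLk hτ
      · exact hLk (hIL hτ)
      · obtain ⟨-, hu, -, he, -⟩ := (mem_edgeLowerLink_of_lt huv).1 hσ
        refine mem_lowerLink.2 ⟨hK.2 _ he _ (subset_insert _ _) (insert_nonempty _ _),
          by simp [hne, hu], he, fun x hx => ?_⟩
        rcases mem_insert.1 hx with rfl | hx
        · exact hcross.hvu
        · exact (mem_lowerLink.1 (hLk (hIL hσ))).2.2.2 x hx
      · exact mem_lowerLink.2 ⟨hK.2 _ hedge _ (subset_insert _ _) (singleton_nonempty _),
          by simpa using hne, hedge, by simpa using hcross.hvu⟩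
  · ext τ
    rw [mem_inter, mem_cone]
    constructor
    · rintro ⟨hτ, hτ' | ⟨σ, -, rfl⟩ | rfl⟩
      · exact hτ'
      · exact absurd (mem_insert_self _ _) (notMem_of_mem_lowerLink huv hτ)
      · exact absurd (mem_singleton_self _) (notMem_of_mem_lowerLink huv hτ)
    · exact fun hτ => ⟨hIL hτ, Or.inl hτ⟩
end

section
/- Let K be an abstract simplicial complex on a vertex type V and let g : V → ℝ be obtained from f : V → ℝ by a single crossing of two vertices u and v of K. If {u, v} ∉ K (the vertices u and v are not connected by an edge of K), then the lower links of u and v are unchanged by the crossing: Lk⁻_g(u) = Lk⁻_f(u) and Lk⁻_g(v) = Lk⁻_f(v). -/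
open Finset

open scoped Classical

/-- The lower link of `w` depends only on how the values at the neighbours of `w` compare with
the value at `w`. -/
theorem lowerLink_congr {V : Type*} [DecidableEq V] {K : Finset (Finset V)} (hK : IsComplex K)
    {f g : V → ℝ} {w : V} (h : ∀ x, ({x, w} : Finset V) ∈ K → (f x < f w ↔ g x < g w)) :
    lowerLink K f w = lowerLink K g w := by
  unfold lowerLink
  refine Finset.filter_congr fun τ _ => and_congr_right fun _ => and_congr_right fun hins =>
    forall₂_congr fun x hx => h x (hK.2 _ hins _ ?_ (Finset.insert_nonempty _ _))
  exact Finset.insert_subset (Finset.mem_insert_of_mem hx)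
    (Finset.singleton_subset_iff.2 (Finset.mem_insert_self _ _))

/-- If the crossing vertices span no edge, no lower link changes. -/
theorem IsCrossing.lowerLink_eq {V : Type*} [DecidableEq V] {K : Finset (Finset V)}
    (hK : IsComplex K) {f g : V → ℝ} {u v : V} (hcross : IsCrossing K f g u v)
    (hedge : ({u, v} : Finset V) ∉ K) (w : V) : lowerLink K g w = lowerLink K f w := by
  refine lowerLink_congr hK fun x hx => (hcross.others x w ⟨_, hx, by simp⟩ ⟨_, hx, by simp⟩ ?_).symm
  intro hpair
  have hfin : ({x, w} : Finset V) = {u, v} := by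
    apply Finset.coe_injective
    simpa only [Finset.coe_pair] using hpair
  exact hedge (hfin ▸ hx)

/-- if `u` and `v` are not connected by an edge of `K`, their lower
links are unchanged by a single crossing. -/
theorem crossing_lowerLink_unchanged_of_no_edge {V : Type*} [DecidableEq V]
    (K : Finset (Finset V)) (hK : IsComplex K) (f g : V → ℝ) (u v : V)
    (hcross : IsCrossing K f g u v) (hedge : ({u, v} : Finset V) ∉ K) :
    lowerLink K g u = lowerLink K f u ∧ lowerLink K g v = lowerLink K f v := by
  exact ⟨hcross.lowerLink_eq hK hedge u, hcross.lowerLink_eq hK hedge v⟩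
end

section
/- Let K be an abstract simplicial complex on a vertex type V, let g : V → ℝ be obtained from f : V → ℝ by a single crossing of two vertices u and v of K, and suppose {u, v} ∈ K. Then the reduced Euler characteristic of the lower link of v changes by χ̃(Lk⁻_g(v)) − χ̃(Lk⁻_f(v)) = χ̃(I_uv). (This is the Euler-characteristic identity the paper derives for v from the Mayer–Vietoris sequence applied to the decomposition Lk⁻_f(v) = Lk⁻_g(v) ∪ (u ⋆ I_uv), using that the cone u ⋆ I_uv is contractible.) -/
open Finset

open scoped Classical

/-- Vertices other than the crossing pair keep their position relative to `v`. -/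
lemma IsCrossing.lt_right_iff {V : Type*} [DecidableEq V] {K : Finset (Finset V)} {f g : V → ℝ}
    {u v x : V} (h : IsCrossing K f g u v) (hx : IsVertex K x) (hxu : x ≠ u) (hxv : x ≠ v) :
    f x < f v ↔ g x < g v := by
  refine h.others x v hx h.hv fun hs => ?_
  have hmem : x ∈ ({u, v} : Set V) := hs ▸ Set.mem_insert x {v}
  rcases hmem with hx' | hx'
  exacts [hxu hx', hxv hx']

/-- No vertex lies strictly between the two crossing vertices. -/
lemma IsCrossing.lt_left_of_lt_right {V : Type*} [DecidableEq V] {K : Finset (Finset V)}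
    {f g : V → ℝ} {u v x : V} (h : IsCrossing K f g u v) (hx : IsVertex K x)
    (hxu : x ≠ u) (hxv : x ≠ v) (hlt : f x < f v) : f x < f u := by
  by_contra! hle
  have hux : f u < f x := lt_of_le_of_ne hle fun he => hxu (h.injf u x h.hu hx he).symm
  have hne : ({u, x} : Set V) ≠ {u, v} := by
    intro hs
    have hmem : x ∈ ({u, v} : Set V) := hs ▸ Set.mem_insert_of_mem u rfl
    rcases hmem with hx' | hx'
    exacts [hxu hx', hxv hx']
  have hg : g u < g x := (h.others u x h.hu hx hne).1 hux
  exact lt_asymm h.hvu (hg.trans ((h.lt_right_iff hx hxu hxv).1 hlt))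

/-- After the crossing, the lower link of `v` loses exactly the simplices containing `u`. -/
lemma IsCrossing.lowerLink_right_eq {V : Type*} [DecidableEq V] {K : Finset (Finset V)}
    {f g : V → ℝ} {u v : V} (h : IsCrossing K f g u v) :
    lowerLink K g v = (lowerLink K f v).filter fun τ => u ∉ τ := by
  ext τ
  simp only [lowerLink, mem_filter]
  constructor
  · rintro ⟨hτ, hv, hi, hlt⟩
    have hu : u ∉ τ := fun hu => lt_asymm h.hvu (hlt u hu)
    refine ⟨⟨hτ, hv, hi, fun x hx => ?_⟩, hu⟩
    exact (h.lt_right_iff ⟨τ, hτ, hx⟩ (ne_of_mem_of_not_mem hx hu)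
      (ne_of_mem_of_not_mem hx hv)).2 (hlt x hx)
  · rintro ⟨⟨hτ, hv, hi, hlt⟩, hu⟩
    refine ⟨hτ, hv, hi, fun x hx => ?_⟩
    exact (h.lt_right_iff ⟨τ, hτ, hx⟩ (ne_of_mem_of_not_mem hx hu)
      (ne_of_mem_of_not_mem hx hv)).1 (hlt x hx)

/-- The simplices of the lower link of `v` containing `u` are `{u}` and the joins of `u` with
simplices of the lower link of the edge. -/
lemma IsCrossing.filter_mem_lowerLink_right {V : Type*} [DecidableEq V] {K : Finset (Finset V)}
    (hK : IsComplex K) {f g : V → ℝ} {u v : V} (h : IsCrossing K f g u v)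
    (hedge : ({u, v} : Finset V) ∈ K) :
    (lowerLink K f v).filter (fun τ => u ∈ τ) =
      (insert ∅ (edgeLowerLink K f u v)).image (insert u) := by
  have huv : u ≠ v := fun he => absurd h.huv (by simp [he])
  ext τ
  simp only [lowerLink, edgeLowerLink, mem_filter, mem_image, mem_insert]
  constructor
  · rintro ⟨⟨hτ, hv, hi, hlt⟩, hu⟩
    refine ⟨τ.erase u, ?_, insert_erase hu⟩
    rcases (τ.erase u).eq_empty_or_nonempty with he | hne
    · exact Or.inl he
    · refine Or.inr ⟨hK.2 τ hτ _ (erase_subset u τ) hne, notMem_erase u τ,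
        fun hm => hv (mem_of_mem_erase hm), ?_, fun x hx => ?_⟩
      · rwa [insert_comm, insert_erase hu]
      · have hxτ := mem_of_mem_erase hx
        have hxv := hlt x hxτ
        exact lt_min (h.lt_left_of_lt_right ⟨τ, hτ, hxτ⟩ (ne_of_mem_erase hx)
          (ne_of_mem_of_not_mem hxτ hv) hxv) hxv
  · rintro ⟨σ, rfl | ⟨hσ, hu, hv, hi, hlt⟩, rfl⟩
    · refine ⟨⟨hK.2 _ hedge _ (by simp) (by simp), by simpa using huv.symm, ?_, ?_⟩, by simp⟩
      · rwa [insert_comm]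
      · simpa using h.huv
    · refine ⟨⟨hK.2 _ hi _ (insert_subset_insert u (subset_insert v σ)) (insert_nonempty u σ),
        by simp [huv.symm, hv], by rwa [insert_comm], fun x hx => ?_⟩, mem_insert_self u σ⟩
      rcases mem_insert.1 hx with rfl | hx
      · exact h.huv
      · exact (hlt x hx).trans_le (min_le_right _ _)

/-- Signed count of the simplices of a cone that contain its apex. -/
lemma sum_image_insert_apex {V : Type*} [DecidableEq V] {L : Finset (Finset V)} {u : V}
    (hne : ∀ τ ∈ L, τ.Nonempty) (hu : ∀ τ ∈ L, u ∉ τ) :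
    ∑ τ ∈ (insert ∅ L).image (insert u), (-1 : ℤ) ^ (τ.card - 1) = -chiTilde L := by
  have hu' : ∀ τ ∈ insert ∅ L, u ∉ τ := by simpa using hu
  have hempty : ∅ ∉ L := fun h => not_nonempty_empty (hne ∅ h)
  have hsum : ∑ τ ∈ L, (-1 : ℤ) ^ ((insert u τ).card - 1) = -∑ τ ∈ L, (-1 : ℤ) ^ (τ.card - 1) := by
    rw [← sum_neg_distrib]
    refine sum_congr rfl fun τ hτ => ?_
    obtain ⟨n, hn⟩ := Nat.exists_eq_succ_of_ne_zero (card_ne_zero.2 (hne τ hτ))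
    simp [card_insert_of_notMem (hu τ hτ), hn, pow_succ]
  rw [sum_image fun σ hσ τ hτ he => by
      rw [← erase_insert (hu' σ hσ), he, erase_insert (hu' τ hτ)],
    sum_insert hempty, hsum, chiTilde]
  simp
  ring

/-- if `{u,v} ∈ K`, the reduced Euler characteristic of the lower link
of `v` changes by `χ̃(I_uv)` at the crossing. -/
theorem crossing_chiTilde_v {V : Type*} [DecidableEq V]
    (K : Finset (Finset V)) (hK : IsComplex K) (f g : V → ℝ) (u v : V)
    (hcross : IsCrossing K f g u v) (hedge : ({u, v} : Finset V) ∈ K) :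
    chiTilde (lowerLink K g v) - chiTilde (lowerLink K f v) =
      chiTilde (edgeLowerLink K f u v) := by
  have hcone := sum_image_insert_apex (L := edgeLowerLink K f u v) (u := u)
    (fun τ hτ => hK.1 τ (mem_filter.1 hτ).1) (fun τ hτ => (mem_filter.1 hτ).2.1)
  rw [← hcross.filter_mem_lowerLink_right hK hedge] at hcone
  have hsplit := sum_filter_add_sum_filter_not (lowerLink K f v) (fun τ => u ∈ τ)
    (fun τ => (-1 : ℤ) ^ (τ.card - 1))
  rw [hcross.lowerLink_right_eq]
  simp only [chiTilde] at hcone ⊢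
  linarith
end

section
/- Let K be an abstract simplicial complex on a vertex type V with f : V → ℝ injective on the vertices of K, and let s ∈ ℝ. Then the Euler characteristic of the sublevel complex equals the sum of the local time-varying Euler characteristic contributions of the vertices: Σ_{σ ∈ K, f(x) ≤ s for all x ∈ σ} (−1)^{|σ|−1} = Σ_{v vertex of K, f(v) ≤ s} ( 1 + Σ_{τ ∈ Lk⁻_f(v)} (−1)^{|τ|} ). (Since 1 + Σ_{τ ∈ Lk⁻_f(v)} (−1)^{|τ|} = Σ_i (−1)^i β_i(v) by the Euler–Poincaré formula, this is the paper's identity ECC(K_t, s) = Σ_{v ∈ V} localTVECC_v(s, t) for the lower star filtration induced by f = f_t.) -/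
open Finset

open scoped Classical

/-- The simplices of `K` whose `f`-maximal vertex is `v`, i.e. the lower star of `v`, are the
joins of `v` with the empty set and with the simplices of the lower link of `v`. -/
theorem filter_max_eq_image_insert_lowerLink {V : Type*} [DecidableEq V]
    {K : Finset (Finset V)} (hK : IsComplex K) {f : V → ℝ} (hinj : InjOnVerts K f)
    {v : V} (hv : IsVertex K v) :
    K.filter (fun σ => v ∈ σ ∧ ∀ x ∈ σ, f x ≤ f v) =
      (insert ∅ (lowerLink K f v)).image (insert v) := by
  ext σ
  simp only [mem_filter, mem_image, mem_insert, lowerLink]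
  constructor
  · rintro ⟨hσ, hvσ, hmax⟩
    refine ⟨σ.erase v, ?_, insert_erase hvσ⟩
    rcases (σ.erase v).eq_empty_or_nonempty with h | h
    · exact Or.inl h
    · refine Or.inr ⟨hK.2 σ hσ _ (erase_subset _ _) h, notMem_erase v σ, ?_, fun x hx => ?_⟩
      · rwa [insert_erase hvσ]
      · obtain ⟨hxv, hxσ⟩ := mem_erase.1 hx
        exact lt_of_le_of_ne (hmax x hxσ) fun h => hxv (hinj x v ⟨σ, hσ, hxσ⟩ hv h)
  · rintro ⟨τ, rfl | ⟨-, -, hτ, hlt⟩, rfl⟩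
    · obtain ⟨σ, hσ, hvσ⟩ := hv
      refine ⟨hK.2 σ hσ _ ?_ (insert_nonempty _ _), mem_insert_self _ _, ?_⟩
      · simpa using hvσ
      · simp
    · refine ⟨hτ, mem_insert_self _ _, fun x hx => ?_⟩
      rcases mem_insert.1 hx with rfl | hx
      · exact le_rfl
      · exact (hlt x hx).le

/-- The signed count of the lower star of `v` is the local contribution of `v`. -/
theorem sum_filter_max_eq_one_add_sum_lowerLink {V : Type*} [DecidableEq V]
    {K : Finset (Finset V)} (hK : IsComplex K) {f : V → ℝ} (hinj : InjOnVerts K f)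
    {v : V} (hv : IsVertex K v) :
    ∑ σ ∈ K.filter (fun σ => v ∈ σ ∧ ∀ x ∈ σ, f x ≤ f v), (-1 : ℤ) ^ (σ.card - 1) =
      1 + ∑ τ ∈ lowerLink K f v, (-1 : ℤ) ^ τ.card := by
  have hmem : ∀ τ ∈ insert ∅ (lowerLink K f v), v ∉ τ := by
    intro τ hτ
    rcases mem_insert.1 hτ with rfl | hτ
    · exact notMem_empty v
    · exact (mem_filter.1 hτ).2.1
  have hempty : ∅ ∉ lowerLink K f v := fun h =>
    not_nonempty_empty (hK.1 _ (mem_filter.1 h).1)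
  rw [filter_max_eq_image_insert_lowerLink hK hinj hv, sum_image, sum_congr rfl
    (g := fun τ => (-1 : ℤ) ^ τ.card), sum_insert hempty]
  · simp
  · intro τ hτ
    rw [card_insert_of_notMem (hmem τ hτ), Nat.add_sub_cancel]
  · intro τ hτ τ' hτ' h
    rw [← erase_insert (hmem τ hτ), h, erase_insert (hmem τ' hτ')]

/-- The sublevel complex is the union of the lower stars of its vertices. -/
theorem filter_le_eq_biUnion_filter_max {V : Type*} [DecidableEq V]
    {K : Finset (Finset V)} (hK : IsComplex K) (f : V → ℝ) (s : ℝ) :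
    K.filter (fun σ => ∀ x ∈ σ, f x ≤ s) =
      ((K.sup id).filter (fun v => f v ≤ s)).biUnion
        (fun v => K.filter (fun σ => v ∈ σ ∧ ∀ x ∈ σ, f x ≤ f v)) := by
  ext σ
  simp only [mem_filter, mem_biUnion, mem_sup, id]
  constructor
  · rintro ⟨hσ, hs⟩
    obtain ⟨v, hv, hmax⟩ := exists_max_image σ f (hK.1 σ hσ)
    exact ⟨v, ⟨⟨σ, hσ, hv⟩, hs v hv⟩, hσ, hv, hmax⟩
  · rintro ⟨v, ⟨-, hvs⟩, hσ, -, hmax⟩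
    exact ⟨hσ, fun x hx => (hmax x hx).trans hvs⟩

/-- the Euler characteristic of the sublevel complex equals the sum of
the local (time-varying) Euler characteristic contributions of the vertices. -/
theorem ecc_eq_sum_local {V : Type*} [DecidableEq V]
    (K : Finset (Finset V)) (hK : IsComplex K) (f : V → ℝ)
    (hinj : InjOnVerts K f) (s : ℝ) :
    ∑ σ ∈ K.filter (fun σ => ∀ x ∈ σ, f x ≤ s), (-1 : ℤ) ^ (σ.card - 1) =
      ∑ v ∈ (K.sup id).filter (fun v => f v ≤ s),
        (1 + ∑ τ ∈ lowerLink K f v, (-1 : ℤ) ^ τ.card) := by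
  rw [filter_le_eq_biUnion_filter_max hK, sum_biUnion]
  · refine sum_congr rfl fun v hv => ?_
    exact sum_filter_max_eq_one_add_sum_lowerLink hK hinj (mem_sup.1 (mem_filter.1 hv).1)
  · intro v _ w _ hvw
    refine disjoint_left.2 fun σ hσv hσw => hvw ?_
    obtain ⟨hσ, hv, hmaxv⟩ := mem_filter.1 hσv
    obtain ⟨-, hw, hmaxw⟩ := mem_filter.1 hσw
    exact hinj v w ⟨σ, hσ, hv⟩ ⟨σ, hσ, hw⟩ (le_antisymm (hmaxw v hv) (hmaxv w hw))
end
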